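/- arXiv:2509.03663 — 3 statements merged into one kernel-verified Lean document; each statement's English description precedes it below -/
import Mathlib

section
/- Let A be a Hermitian algebra, let a ∈ A be self-adjoint, and for each n ≥ 1 let yₙ ∈ A be a self-adjoint element commuting with a such that σ(yₙ) ⊆ (0, ∞) and yₙ² = a² + (1/n²)·1. If (vₙ) is a sequence in A such that s(yₙ·vₙ) → 0, then s(a·vₙ) → 0, where s denotes the Pták functional. -/
open scoped ComplexConjugate

/-- A character of a complex algebra: a nonzero linear multiplicative functional. -/
def IsCharacter {A : Type*} [Ring A] [Algebra ℂ A] (ψ : A → ℂ) : Prop :=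
  ψ ≠ 0 ∧ IsLinearMap ℂ ψ ∧ ∀ x y : A, ψ (x * y) = ψ x * ψ y

/-- φ is spectrally multiplicative if φ(x)·φ(y) ∈ σ(x·y) for all x, y. -/
def SpectrallyMultiplicative {A : Type*} [Ring A] [Algebra ℂ A] (φ : A → ℂ) : Prop :=
  ∀ x y : A, φ x * φ y ∈ spectrum ℂ (x * y)

/-- The Pták functional s(x) = √(ρ(x⋆x)). -/
noncomputable def ptak {A : Type*} [NormedRing A] [NormedAlgebra ℂ A] [StarRing A] (x : A) : ℝ :=
  Real.sqrt ((spectralRadius ℂ (star x * x)).toReal)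

/-- The real part Re(x) = (x + x⋆)/2. -/
noncomputable def reP {A : Type*} [Ring A] [Algebra ℂ A] [StarRing A] (x : A) : A :=
  (2 : ℂ)⁻¹ • (x + star x)

/-- The imaginary part Im(x) = (x - x⋆)/(2i). -/
noncomputable def imP {A : Type*} [Ring A] [Algebra ℂ A] [StarRing A] (x : A) : A :=
  ((2 : ℂ) * Complex.I)⁻¹ • (x - star x)

section SquareRoot

open Finset in
/-- The Catalan series gives a square root of `1 - 4 t` as soon as it converges absolutely. -/
theorem exists_mul_self_eq_one_sub_four_smul {B : Type*} [NormedCommRing B] [NormedAlgebra ℂ B]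
    [CompleteSpace B] (t : B) (ht : Summable fun n : ℕ => ‖(catalan n : B) * t ^ n‖) :
    ∃ w : B, w * w = 1 - 4 * t := by
  set f : ℕ → B := fun n => (catalan n : B) * t ^ n
  have hprod : (∑' n, f n) * ∑' n, f n = ∑' n, (catalan (n + 1) : B) * t ^ n := by
    rw [tsum_mul_tsum_eq_tsum_sum_antidiagonal_of_summable_norm ht ht]
    refine tsum_congr fun n => ?_
    rw [catalan_succ', Nat.cast_sum, sum_mul]
    refine sum_congr rfl fun ij hij => ?_
    rw [← mem_antidiagonal.1 hij]
    simp only [Nat.cast_mul]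
    ring
  have hsummable : Summable fun n => (catalan (n + 1) : B) * t ^ n := by
    have h := summable_norm_sum_mul_antidiagonal_of_summable_norm ht ht
    refine (Summable.of_norm h).congr fun n => ?_
    rw [catalan_succ', Nat.cast_sum, sum_mul]
    refine sum_congr rfl fun ij hij => ?_
    rw [← mem_antidiagonal.1 hij]
    simp only [Nat.cast_mul]
    ring
  have hrec : ∑' n, f n = 1 + t * ((∑' n, f n) * ∑' n, f n) := by
    rw [hprod, ← hsummable.tsum_mul_left, (Summable.of_norm ht).tsum_eq_zero_add]
    congr 1
    · simp
    · exact tsum_congr fun n => by ring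
  refine ⟨1 - 2 * t * ∑' n, f n, ?_⟩
  linear_combination (-4 * t) * hrec

theorem catalan_le_four_pow (n : ℕ) : catalan n ≤ 4 ^ n := by
  rw [catalan_eq_centralBinom_div]
  calc n.centralBinom / (n + 1) ≤ n.centralBinom := Nat.div_le_self _ _
    _ ≤ 2 ^ (2 * n) := Nat.choose_le_two_pow _ _
    _ = 4 ^ n := by rw [pow_mul]; norm_num

theorem exists_mul_self_eq_one_sub {B : Type*} [NormedCommRing B] [NormedAlgebra ℂ B]
    [CompleteSpace B] (c : B) (hc : Summable fun n : ℕ => ‖c ^ n‖) :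
    ∃ w : B, w * w = 1 - c := by
  obtain ⟨w, hw⟩ := exists_mul_self_eq_one_sub_four_smul ((4 : ℂ)⁻¹ • c) <| by
    refine hc.of_nonneg_of_le (fun n => norm_nonneg _) fun n => ?_
    have hcoe : (catalan n : B) * ((4 : ℂ)⁻¹ • c) ^ n = ((catalan n : ℂ) * (4 ^ n)⁻¹) • c ^ n := by
      rw [smul_pow, mul_smul, inv_pow, ← nsmul_eq_mul, ← Nat.cast_smul_eq_nsmul ℂ]
    rw [hcoe, norm_smul]
    refine mul_le_of_le_one_left (norm_nonneg _) ?_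
    rw [norm_mul, norm_inv, norm_pow, Complex.norm_natCast, Complex.norm_ofNat,
      ← div_eq_mul_inv, div_le_one (by positivity)]
    exact_mod_cast catalan_le_four_pow n
  refine ⟨w, hw.trans ?_⟩
  have h4 : (4 : B) = (4 : ℂ) • (1 : B) := by
    rw [← Algebra.algebraMap_eq_smul_one, map_ofNat]
  rw [h4, smul_mul_smul_comm, one_mul, mul_inv_cancel₀ (by norm_num), one_smul]

end SquareRoot

section SpectralRadius

variable {A : Type*} [NormedRing A] [NormedAlgebra ℂ A]

theorem spectralRadius_mul_comm (x y : A) :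
    spectralRadius ℂ (x * y) = spectralRadius ℂ (y * x) := by
  have key : ∀ x y : A, spectralRadius ℂ (x * y) ≤ spectralRadius ℂ (y * x) := by
    intro x y
    refine iSup₂_le fun z hz => ?_
    by_cases h0 : z = 0
    · simp [h0]
    · have : z ∈ spectrum ℂ (y * x) \ {0} := by
        rw [← spectrum.nonzero_mul_comm]
        exact ⟨hz, h0⟩
      exact le_iSup₂ (f := fun (k : ℂ) (_ : k ∈ spectrum ℂ (y * x)) => (‖k‖₊ : ENNReal)) z this.1
  exact le_antisymm (key x y) (key y x)

theorem spectralRadius_smul_le (k : ℂ) (hk : k ≠ 0) (x : A) :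
    spectralRadius ℂ (k • x) ≤ ‖k‖₊ * spectralRadius ℂ x := by
  refine iSup₂_le fun z hz => ?_
  have hz' : z ∈ spectrum ℂ (Units.mk0 k hk • x) := hz
  rw [spectrum.unit_smul_eq_smul] at hz'
  obtain ⟨s, hs, rfl⟩ := hz'
  change ((‖k * s‖₊ : NNReal) : ENNReal) ≤ _
  rw [nnnorm_mul, ENNReal.coe_mul]
  gcongr
  exact le_iSup₂ (f := fun (k : ℂ) (_ : k ∈ spectrum ℂ x) => (‖k‖₊ : ENNReal)) s hs

theorem isUnit_one_sub_of_spectralRadius_lt_one {x : A} (hx : spectralRadius ℂ x < 1) :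
    IsUnit (1 - x) := by
  have h := spectrum.mem_resolventSet_of_spectralRadius_lt (k := (1 : ℂ)) (by simpa using hx)
  simpa [spectrum.mem_resolventSet_iff] using h

variable [CompleteSpace A]

theorem spectralRadius_le_nnnorm_mul_nnnorm_one (x : A) :
    spectralRadius ℂ x ≤ ‖x‖₊ * ‖(1 : A)‖₊ := by
  simpa using spectrum.spectralRadius_le_pow_nnnorm_pow_one_div ℂ x 0

theorem spectralRadius_ne_top (x : A) : spectralRadius ℂ x ≠ ⊤ :=
  ((spectralRadius_le_nnnorm_mul_nnnorm_one x).trans_lt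
    (ENNReal.mul_lt_top ENNReal.coe_lt_top ENNReal.coe_lt_top)).ne

theorem summable_norm_pow_of_spectralRadius_lt_one {x : A} (hx : spectralRadius ℂ x < 1) :
    Summable fun n : ℕ => ‖x ^ n‖ := by
  obtain ⟨r, hr, hr1⟩ := ENNReal.lt_iff_exists_nnreal_btwn.1 hx
  have hlim := (spectrum.pow_nnnorm_pow_one_div_tendsto_nhds_spectralRadius x).eventually_lt_const hr
  refine Summable.of_norm_bounded_eventually_nat (g := fun n => (r : ℝ) ^ n)
    (summable_geometric_of_lt_one r.2 (by exact_mod_cast hr1)) ?_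
  filter_upwards [hlim, Filter.eventually_ne_atTop 0] with n hn hn0
  have h := pow_le_pow_left₀ zero_le hn.le n
  rw [one_div, ENNReal.rpow_inv_natCast_pow hn0] at h
  rw [norm_norm]
  exact_mod_cast h

/-- Iterating `ρ(hk)² ≤ ρ(h²k²)` and passing to the limit in Gelfand's formula. -/
theorem spectralRadius_mul_le_of_pow_le {h k : A}
    (H : ∀ n : ℕ, spectralRadius ℂ (h * k) ^ 2 ^ n ≤
      spectralRadius ℂ (h ^ 2 ^ n * k ^ 2 ^ n)) :
    spectralRadius ℂ (h * k) ≤ spectralRadius ℂ h * spectralRadius ℂ k := by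
  nontriviality A
  have hpow : Filter.Tendsto (fun n : ℕ => 2 ^ n) Filter.atTop Filter.atTop :=
    tendsto_pow_atTop_atTop_of_one_lt one_lt_two
  have lim (x : A) := (spectrum.pow_nnnorm_pow_one_div_tendsto_nhds_spectralRadius x).comp hpow
  have hlim := ENNReal.Tendsto.mul
    (ENNReal.Tendsto.mul (lim h) (Or.inr (spectralRadius_ne_top k)) (lim k)
      (Or.inr (spectralRadius_ne_top h))) (Or.inr (spectralRadius_ne_top 1)) (lim 1)
    (Or.inr (ENNReal.mul_ne_top (spectralRadius_ne_top h) (spectralRadius_ne_top k)))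
  rw [spectrum.spectralRadius_one, mul_one] at hlim
  refine ge_of_tendsto' hlim fun n => ?_
  have hN : 2 ^ n ≠ 0 := by positivity
  have hle : spectralRadius ℂ (h * k) ^ 2 ^ n ≤
      (‖h ^ 2 ^ n‖₊ : ENNReal) * ‖k ^ 2 ^ n‖₊ * ‖(1 : A)‖₊ := by
    refine ((H n).trans (spectralRadius_le_nnnorm_mul_nnnorm_one _)).trans ?_
    gcongr
    exact_mod_cast nnnorm_mul_le _ _
  have hroot := ENNReal.rpow_le_rpow hle (z := ((2 ^ n : ℕ) : ℝ)⁻¹) (by positivity)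
  rw [ENNReal.pow_rpow_inv_natCast hN, ENNReal.mul_rpow_of_nonneg _ _ (by positivity),
    ENNReal.mul_rpow_of_nonneg _ _ (by positivity)] at hroot
  simpa only [Function.comp_apply, one_div, one_pow] using hroot

end SpectralRadius

section DoubleCommutant

variable {A : Type*} [NormedRing A] [NormedAlgebra ℂ A]

/-- The double commutant of an element: a commutative, closed, inverse-closed subalgebra. -/
def doubleCommutant (c : A) : Subalgebra ℂ A :=
  Subalgebra.centralizer ℂ (Set.centralizer {c})

theorem mem_doubleCommutant {c x : A} :
    x ∈ doubleCommutant c ↔ ∀ g : A, g * c = c * g → g * x = x * g := by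
  simp [doubleCommutant, Subalgebra.mem_centralizer_iff, Set.mem_centralizer_iff, eq_comm]

theorem self_mem_doubleCommutant (c : A) : c ∈ doubleCommutant c :=
  mem_doubleCommutant.2 fun _ hg => hg

instance (c : A) : NormedCommRing (doubleCommutant c) where
  __ := (doubleCommutant c).normedRing
  mul_comm x y := Subtype.ext <|
    mem_doubleCommutant.1 y.2 x (mem_doubleCommutant.1 x.2 c rfl).symm

noncomputable instance (c : A) : NormedAlgebra ℂ (doubleCommutant c) :=
  (doubleCommutant c).toNormedAlgebra

instance [CompleteSpace A] (c : A) : CompleteSpace (doubleCommutant c) :=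
  IsClosed.completeSpace_coe (hs := Set.isClosed_centralizer _)

theorem isUnit_doubleCommutant {c : A} {x : doubleCommutant c} (hx : IsUnit (x : A)) :
    IsUnit x := by
  obtain ⟨u, hu⟩ := hx
  have hmem : (↑u⁻¹ : A) ∈ doubleCommutant c := mem_doubleCommutant.2 fun g hg => by
    have h : Commute g (u : A) := by
      rw [hu]
      exact mem_doubleCommutant.1 x.2 g hg
    exact h.units_inv_right
  refine IsUnit.of_mul_eq_one ⟨_, hmem⟩ (Subtype.ext ?_)
  change (x : A) * ↑u⁻¹ = 1
  rw [← hu, Units.mul_inv]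

theorem apply_mem_spectrum_of_doubleCommutant [CompleteSpace A] {c : A}
    (φ : WeakDual.characterSpace ℂ (doubleCommutant c)) (x : doubleCommutant c) :
    φ x ∈ spectrum ℂ (x : A) := by
  rw [spectrum.mem_iff]
  intro h
  have h' : IsUnit (algebraMap ℂ (doubleCommutant c) (φ x) - x) := isUnit_doubleCommutant h
  exact (AlgHom.apply_mem_spectrum φ x) h'

theorem star_mem_doubleCommutant [StarRing A] {c : A} (hc : star c = c)
    {x : A} (hx : x ∈ doubleCommutant c) : star x ∈ doubleCommutant c := by
  rw [mem_doubleCommutant] at hx ⊢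
  intro g hg
  have h := congrArg star (hx (star g) (by simpa [hc] using (congrArg star hg).symm))
  simpa using h.symm

end DoubleCommutant

section Hermitian

variable {A : Type*} [NormedRing A] [NormedAlgebra ℂ A] [StarRing A]

theorem re_nonneg_of_mem_spectrum_sq
    (hHerm : ∀ a : A, star a = a → ∀ z ∈ spectrum ℂ a, z.im = 0)
    {k : A} (hk : star k = k) {z : ℂ} (hz : z ∈ spectrum ℂ (k ^ 2)) : 0 ≤ z.re ∧ z.im = 0 := by
  rw [spectrum.map_pow_of_pos k two_pos] at hz
  obtain ⟨s, hs, rfl⟩ := hz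
  have him := hHerm k hk s hs
  simp [sq, him, mul_self_nonneg]

theorem spectralRadius_sq_le_one_of_add_sq_eq_one
    (hHerm : ∀ a : A, star a = a → ∀ z ∈ spectrum ℂ a, z.im = 0)
    {b k : A} (hb : star b = b) (hk : star k = k) (hbk : b ^ 2 + k ^ 2 = 1) :
    spectralRadius ℂ (b ^ 2) ≤ 1 := by
  refine iSup₂_le fun z hz => ?_
  obtain ⟨h0, him⟩ := re_nonneg_of_mem_spectrum_sq hHerm hb hz
  have hmem : 1 - z ∈ spectrum ℂ (k ^ 2) := by
    rw [eq_sub_of_add_eq' hbk, ← map_one (algebraMap ℂ A), ← spectrum.singleton_sub_eq]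
    exact Set.sub_mem_sub rfl hz
  obtain ⟨h1, -⟩ := re_nonneg_of_mem_spectrum_sq hHerm hk hmem
  have hz1 : ‖z‖ ≤ 1 := by
    rw [show z = (z.re : ℂ) from Complex.ext rfl (by simpa using him), Complex.norm_real,
      Real.norm_of_nonneg h0]
    simpa using h1
  exact_mod_cast hz1

variable [StarModule ℂ A]

theorem isUnit_one_add_of_star_eq_neg
    (hHerm : ∀ a : A, star a = a → ∀ z ∈ spectrum ℂ a, z.im = 0)
    {k : A} (hk : star k = -k) : IsUnit (1 + k) := by
  by_contra hn
  have hsa : star (Complex.I • k) = Complex.I • k := by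
    simp [star_smul, hk]
  have hmem : -Complex.I ∈ spectrum ℂ (Complex.I • k) := by
    rw [spectrum.mem_iff]
    intro h
    have heq : algebraMap ℂ A (-Complex.I) - Complex.I • k =
        Units.mk0 (-Complex.I) (by simp) • (1 + k) := by
      rw [Units.smul_def, Units.val_mk0, Algebra.algebraMap_eq_smul_one, smul_add, neg_smul,
        neg_smul, sub_eq_add_neg]
    rw [heq] at h
    exact hn ((isUnit_smul_iff _ _).1 h)
  simpa using hHerm _ hsa _ hmem

variable [CompleteSpace A]

/-- Ford's square root lemma, in a Hermitian algebra. -/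
theorem exists_selfAdjoint_mul_self_eq_one_sub
    (hHerm : ∀ a : A, star a = a → ∀ z ∈ spectrum ℂ a, z.im = 0)
    {c : A} (hc : star c = c) (hρ : spectralRadius ℂ c < 1) :
    ∃ w : A, star w = w ∧ w * w = 1 - c := by
  let c' : doubleCommutant c := ⟨c, self_mem_doubleCommutant c⟩
  obtain ⟨w, hw⟩ := exists_mul_self_eq_one_sub c' <|
    show Summable fun n : ℕ => ‖c ^ n‖ from summable_norm_pow_of_spectralRadius_lt_one hρ
  have hwA : (w : A) * w = 1 - c := congrArg Subtype.val hw
  let w' : doubleCommutant c := ⟨star (w : A), star_mem_doubleCommutant hc w.2⟩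
  have hw' : w' * w' = 1 - c' := Subtype.ext <| by
    change star (w : A) * star (w : A) = 1 - c
    rw [← star_mul, hwA, star_sub, star_one, hc]
  have hunit : IsUnit (w + w') := by
    by_contra hn
    obtain ⟨φ, hφ⟩ := WeakDual.CharacterSpace.exists_apply_eq_zero hn
    rw [map_add] at hφ
    have hφc := apply_mem_spectrum_of_doubleCommutant φ c'
    have hre : (φ c').re < 1 := by
      have h1 : (‖φ c'‖₊ : ENNReal) < 1 := lt_of_le_of_lt
        (le_iSup₂ (f := fun (k : ℂ) (_ : k ∈ spectrum ℂ c) => (‖k‖₊ : ENNReal)) _ hφc) hρ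
      have h2 : ‖φ c'‖ < 1 := by exact_mod_cast h1
      exact (Complex.re_le_norm _).trans_lt h2
    have him := hHerm (Complex.I • ((w : A) - star (w : A)))
      (by
        rw [star_smul, star_sub, star_star, Complex.star_def, Complex.conj_I, neg_smul,
          ← smul_neg, neg_sub]) _
      (apply_mem_spectrum_of_doubleCommutant φ (Complex.I • (w - w')))
    have hsq : φ w * φ w = 1 - φ c' := by
      rw [← map_mul, hw, map_sub, map_one]
    have hneg : φ w' = -φ w := by linear_combination hφ
    rw [map_smul, map_sub, hneg, smul_eq_mul] at him
    have hsq_re := congrArg Complex.re hsq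
    simp only [Complex.mul_im, Complex.I_re, Complex.I_im, Complex.sub_re, Complex.neg_re,
      Complex.mul_re, Complex.one_re] at him hsq_re
    nlinarith [sq_nonneg (φ w).im]
  have hzero : (w - w') * (w + w') = 0 := by linear_combination hw - hw'
  have heq : w = w' := sub_eq_zero.1 (hunit.mul_left_eq_zero.1 hzero)
  exact ⟨w, (congrArg Subtype.val heq).symm, hwA⟩

theorem isUnit_one_sub_add
    (hHerm : ∀ a : A, star a = a → ∀ z ∈ spectrum ℂ a, z.im = 0)
    {c k : A} (hc : star c = c) (hρ : spectralRadius ℂ c < 1) (hk : star k = -k) :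
    IsUnit (1 - c + k) := by
  obtain ⟨w, hw, hww⟩ := exists_selfAdjoint_mul_self_eq_one_sub hHerm hc hρ
  have hu : IsUnit w := by
    rw [← isUnit_pow_iff two_ne_zero, sq, hww]
    exact isUnit_one_sub_of_spectralRadius_lt_one hρ
  obtain ⟨u, rfl⟩ := hu
  have hinv : star (↑u⁻¹ : A) = ↑u⁻¹ := by
    rw [← Units.coe_star_inv]
    exact congrArg (fun v : Aˣ => (↑v⁻¹ : A)) (Units.ext hw)
  have h := isUnit_one_add_of_star_eq_neg hHerm (k := ↑u⁻¹ * k * ↑u⁻¹) (by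
    simp only [star_mul, hinv, hk]
    noncomm_ring)
  have heq : 1 - c + k = u * (1 + ↑u⁻¹ * k * ↑u⁻¹) * u := by
    rw [← hww]
    simp [mul_add, add_mul, mul_assoc]
  rw [heq]
  exact (u.isUnit.mul h).mul u.isUnit

theorem isUnit_one_sub_of_spectralRadius_star_mul_self_lt_one
    (hHerm : ∀ a : A, star a = a → ∀ z ∈ spectrum ℂ a, z.im = 0)
    {x : A} (hx : spectralRadius ℂ (star x * x) < 1) : IsUnit (1 - x) := by
  have hl : IsUnit ((1 + star x) * (1 - x)) := by
    have h := isUnit_one_sub_add hHerm (c := star x * x) (k := star x - x) (by simp) hx (by simp)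
    convert h using 1
    noncomm_ring
  have hr : IsUnit ((1 - x) * (1 + star x)) := by
    have h := isUnit_one_sub_add hHerm (c := x * star x) (k := star x - x) (by simp)
      (by rwa [spectralRadius_mul_comm]) (by simp)
    convert h using 1
    noncomm_ring
  obtain ⟨l, hl⟩ := hl.exists_left_inv
  obtain ⟨r, hr⟩ := hr.exists_right_inv
  exact isUnit_iff_exists_and_exists.2
    ⟨⟨_, (mul_assoc _ _ _).symm.trans hr⟩, ⟨_, (mul_assoc _ _ _).trans hl⟩⟩

/-- Pták's fundamental inequality. -/
theorem spectralRadius_sq_le_spectralRadius_star_mul_self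
    (hHerm : ∀ a : A, star a = a → ∀ z ∈ spectrum ℂ a, z.im = 0) (x : A) :
    spectralRadius ℂ x ^ 2 ≤ spectralRadius ℂ (star x * x) := by
  have key : ∀ z ∈ spectrum ℂ x, (‖z‖₊ : ENNReal) ^ 2 ≤ spectralRadius ℂ (star x * x) := by
    intro z hz
    by_contra! hlt
    have hz0 : z ≠ 0 := by
      rintro rfl
      simp at hlt
    refine hz ?_
    have hρ : spectralRadius ℂ (star (z⁻¹ • x) * (z⁻¹ • x)) < 1 := by
      have heq : star (z⁻¹ • x) * (z⁻¹ • x) = (star z⁻¹ * z⁻¹) • (star x * x) := by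
        rw [star_smul, smul_mul_smul_comm]
      rw [heq]
      refine (spectralRadius_smul_le _ (by simp [hz0]) _).trans_lt ?_
      have hn : ((‖star z⁻¹ * z⁻¹‖₊ : NNReal) : ENNReal) = ((‖z‖₊ : ENNReal) ^ 2)⁻¹ := by
        rw [nnnorm_mul, nnnorm_star, nnnorm_inv, ← ENNReal.coe_pow, ← ENNReal.coe_inv
          (by simpa using hz0)]
        congr 1
        rw [sq, mul_inv]
      rw [hn, mul_comm, ← div_eq_mul_inv]
      exact ENNReal.div_lt_of_lt_mul (by simpa using hlt)
    have h := isUnit_one_sub_of_spectralRadius_star_mul_self_lt_one hHerm hρ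
    have heq : algebraMap ℂ A z - x = Units.mk0 z hz0 • (1 - z⁻¹ • x) := by
      rw [Units.smul_def, Units.val_mk0, smul_sub, smul_inv_smul₀ hz0,
        Algebra.algebraMap_eq_smul_one]
    rw [spectrum.mem_resolventSet_iff, heq]
    exact (isUnit_smul_iff _ _).2 h
  nontriviality A
  obtain ⟨z, hz, hzρ⟩ := spectrum.exists_nnnorm_eq_spectralRadius x
  rw [← hzρ]
  exact key z hz

theorem spectralRadius_mul_le_of_selfAdjoint
    (hHerm : ∀ a : A, star a = a → ∀ z ∈ spectrum ℂ a, z.im = 0)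
    {h k : A} (hh : star h = h) (hk : star k = k) :
    spectralRadius ℂ (h * k) ≤ spectralRadius ℂ h * spectralRadius ℂ k := by
  refine spectralRadius_mul_le_of_pow_le fun n => ?_
  induction n with
  | zero => simp
  | succ n ih =>
    calc spectralRadius ℂ (h * k) ^ 2 ^ (n + 1)
        = (spectralRadius ℂ (h * k) ^ 2 ^ n) ^ 2 := by rw [pow_succ, pow_mul]
      _ ≤ spectralRadius ℂ (h ^ 2 ^ n * k ^ 2 ^ n) ^ 2 := by gcongr
      _ ≤ _ := spectralRadius_sq_le_spectralRadius_star_mul_self hHerm _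
      _ = spectralRadius ℂ (h ^ 2 ^ (n + 1) * k ^ 2 ^ (n + 1)) := by
        rw [star_mul, star_pow, star_pow, hh, hk, mul_assoc, spectralRadius_mul_comm,
          pow_succ 2 n, mul_two, pow_add, pow_add]
        simp only [mul_assoc]

theorem ptak_mul_le_ptak_mul
    (hHerm : ∀ a : A, star a = a → ∀ z ∈ spectrum ℂ a, z.im = 0)
    {a y k : A} (ha : star a = a) (hy : star y = y) (hk : star k = k)
    (hay : a * y = y * a) (hky : k * y = y * k) (hunit : IsUnit y)
    (hsq : y ^ 2 = a ^ 2 + k ^ 2) (v : A) : ptak (a * v) ≤ ptak (y * v) := by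
  obtain ⟨u, rfl⟩ := hunit
  have hinv : star (↑u⁻¹ : A) = ↑u⁻¹ := by
    rw [← Units.coe_star_inv]
    exact congrArg (fun v : Aˣ => (↑v⁻¹ : A)) (Units.ext hy)
  have hau : a * ↑u⁻¹ = ↑u⁻¹ * a := Commute.units_inv_right (show Commute a u from hay)
  have hku : k * ↑u⁻¹ = ↑u⁻¹ * k := Commute.units_inv_right (show Commute k u from hky)
  have hb : star (a * ↑u⁻¹) = a * (↑u⁻¹ : A) := by rw [star_mul, hinv, ha, hau]
  have hk' : star (k * ↑u⁻¹) = k * (↑u⁻¹ : A) := by rw [star_mul, hinv, hk, hku]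
  have hone : (a * ↑u⁻¹) ^ 2 + (k * ↑u⁻¹) ^ 2 = (1 : A) := by
    rw [Commute.mul_pow hau, Commute.mul_pow hku, ← add_mul, ← hsq, ← Units.val_pow_eq_pow_val,
      ← Units.val_pow_eq_pow_val, inv_pow, Units.mul_inv]
  have hρ := spectralRadius_sq_le_one_of_add_sq_eq_one hHerm hb hk' hone
  refine Real.sqrt_le_sqrt (ENNReal.toReal_mono (spectralRadius_ne_top _) ?_)
  have hav : a * v = a * ↑u⁻¹ * (u * v) := by simp [mul_assoc]
  calc spectralRadius ℂ (star (a * v) * (a * v))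
      = spectralRadius ℂ ((a * ↑u⁻¹) ^ 2 * ((u * v) * star (u * v))) := by
        rw [hav, star_mul (a * _), hb, mul_assoc, spectralRadius_mul_comm, sq]
        simp only [mul_assoc]
    _ ≤ spectralRadius ℂ ((a * ↑u⁻¹) ^ 2) * spectralRadius ℂ ((u * v) * star (u * v)) :=
        spectralRadius_mul_le_of_selfAdjoint hHerm (by rw [star_pow, hb]) (by simp)
    _ ≤ 1 * spectralRadius ℂ ((u * v) * star (u * v)) := by gcongr
    _ = spectralRadius ℂ (star (u * v) * (u * v)) := by
        rw [one_mul, spectralRadius_mul_comm]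

end Hermitian

theorem stmt_3 {A : Type*} [NormedRing A] [NormedAlgebra ℂ A] [CompleteSpace A]
    [StarRing A] [StarModule ℂ A]
    (hHerm : ∀ a : A, star a = a → ∀ z ∈ spectrum ℂ a, z.im = 0)
    (a : A) (ha : star a = a) (y v : ℕ → A)
    (hysa : ∀ n : ℕ, 1 ≤ n → star (y n) = y n)
    (hcomm : ∀ n : ℕ, 1 ≤ n → a * y n = y n * a)
    (hyspec : ∀ n : ℕ, 1 ≤ n → spectrum ℂ (y n) ⊆ Complex.ofReal '' Set.Ioi 0)
    (hysq : ∀ n : ℕ, 1 ≤ n → y n ^ 2 = a ^ 2 + (((n : ℂ) ^ 2)⁻¹) • 1)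
    (hv : Filter.Tendsto (fun n => ptak (y n * v n)) Filter.atTop (nhds 0)) :
    Filter.Tendsto (fun n => ptak (a * v n)) Filter.atTop (nhds 0) := by
  refine squeeze_zero' (Filter.Eventually.of_forall fun n => Real.sqrt_nonneg _) ?_ hv
  filter_upwards [Filter.eventually_ge_atTop 1] with n hn
  refine ptak_mul_le_ptak_mul hHerm (k := ((n : ℂ)⁻¹) • 1) ha (hysa n hn) (by simp [star_smul])
    (hcomm n hn) (by simp) ?_ ?_ (v n)
  · rw [← spectrum.zero_notMem_iff ℂ]
    intro h
    obtain ⟨r, hr, hr0⟩ := hyspec n hn h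
    exact (ne_of_gt hr) (by exact_mod_cast hr0)
  · rw [hysq n hn, smul_pow, one_pow, inv_pow]
end

section
/- Let A be a Hermitian algebra and let φ : A → ℂ be a continuous spectrally multiplicative function with φ(1) = 1. If α ∈ ℂ and x ∈ A satisfies φ(Re(x)) + i·φ(Im(x)) = 0, then there exists a real number c ∈ [0, 1] such that φ(α·1 + x) = c·α. -/
open scoped ComplexConjugate

/-- Shifted self-adjoint elements are invertible off the real axis. -/
theorem isUnit_selfAdjoint_add {A : Type*} [Ring A] [Algebra ℂ A] [StarRing A]
    (hHerm : ∀ a : A, star a = a → ∀ z ∈ spectrum ℂ a, z.im = 0)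
    {x : A} (hx : star x = x) {l : ℂ} (hl : l.im ≠ 0) : IsUnit (x + algebraMap ℂ A l) := by
  by_contra h
  refine hl ?_
  have : -l ∈ spectrum ℂ x := by
    rw [spectrum.mem_iff]
    intro h2
    apply h
    have := h2.neg
    rwa [map_neg, neg_sub, sub_neg_eq_add] at this
  simpa using hHerm x hx _ this

theorem im_mul_re_eq_of_not_isUnit {A : Type*} [Ring A] [Algebra ℂ A] [StarRing A]
    (hHerm : ∀ a : A, star a = a → ∀ z ∈ spectrum ℂ a, z.im = 0)
    {x : A} (hx : star x = x) {d e : ℂ}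
    (h : ¬ IsUnit (d • x + algebraMap ℂ A e)) :
    (d = 0 → e = 0) ∧ e.im * d.re = e.re * d.im := by
  by_cases hd : d = 0
  · have he : e = 0 := by
      by_contra he
      apply h
      rw [hd, zero_smul, zero_add]
      exact (IsUnit.mk0 e he).map (algebraMap ℂ A)
    simp [hd, he]
  · refine ⟨fun h0 => absurd h0 hd, ?_⟩
    have hm : -(e / d) ∈ spectrum ℂ x := by
      rw [spectrum.mem_iff]
      intro h2
      apply h
      have h3 := ((IsUnit.mk0 (-d) (neg_ne_zero.2 hd)).map (algebraMap ℂ A)).mul h2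
      convert h3 using 1
      rw [mul_sub, ← map_mul, ← Algebra.smul_def]
      have : -d * -(e / d) = e := by field_simp
      rw [this, neg_smul]
      abel
    have h0 := hHerm x hx _ hm
    have hn : Complex.normSq d ≠ 0 := by simpa using hd
    rw [Complex.neg_im, neg_eq_zero, Complex.div_im] at h0
    field_simp at h0
    linarith

/-- A continuous unital function whose ratios lie in the spectra of ratios commutes with scalar
shifts of self-adjoint elements. -/
theorem ratio_apply_add_algebraMap {A : Type*} [NormedRing A] [NormedAlgebra ℂ A] [StarRing A]
    (hHerm : ∀ a : A, star a = a → ∀ z ∈ spectrum ℂ a, z.im = 0)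
    {θ : A → ℂ} (hcont : Continuous θ) (h1 : θ 1 = 1)
    (hR : ∀ (x : A) (u : Aˣ), θ x * (θ u)⁻¹ ∈ spectrum ℂ (x * ↑u⁻¹))
    {x : A} (hx : star x = x) (l : ℂ) :
    θ (x + algebraMap ℂ A l) = θ x + l := by
  have hspec : ∀ y : A, θ y ∈ spectrum ℂ y := fun y => by simpa [h1] using hR y 1
  have hreal : ∀ l : ℂ, ∃ r : ℝ, θ (x + algebraMap ℂ A l) = r + l := by
    intro l
    have h := hspec (x + algebraMap ℂ A l)
    have h2 : θ (x + algebraMap ℂ A l) - l ∈ spectrum ℂ x := by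
      rw [spectrum.mem_iff] at h ⊢
      convert h using 2
      rw [map_sub]
      abel
    have h3 := hHerm x hx _ h2
    refine ⟨(θ (x + algebraMap ℂ A l) - l).re, ?_⟩
    have : (((θ (x + algebraMap ℂ A l) - l).re : ℝ) : ℂ) = θ (x + algebraMap ℂ A l) - l :=
      Complex.ext (by simp) (by simpa using h3.symm)
    rw [this]
    ring
  choose r hr using hreal
  have hne : ∀ u : Aˣ, θ u ≠ 0 := fun u h0 => spectrum.zero_notMem ℂ u.isUnit (h0 ▸ hspec u)
  have key : ∀ l m : ℂ, m.im ≠ 0 →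
      ((r l - r m + l - m : ℂ) = 0 → (r l * m - r m * l : ℂ) = 0) ∧
        (r l * m - r m * l : ℂ).im * (r l - r m + l - m : ℂ).re =
          (r l * m - r m * l : ℂ).re * (r l - r m + l - m : ℂ).im := by
    intro l m hm
    obtain ⟨u, hu⟩ := isUnit_selfAdjoint_add hHerm hx hm
    have h := hR (x + algebraMap ℂ A l) u
    have hn : θ u ≠ 0 := hne u
    apply im_mul_re_eq_of_not_isUnit hHerm hx
    intro hU
    rw [spectrum.mem_iff] at h
    apply h
    have h3 := (((IsUnit.mk0 _ (inv_ne_zero hn)).map (algebraMap ℂ A)).mul hU).mul u⁻¹.isUnit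
    convert h3 using 1
    rw [Units.eq_mul_inv_iff_mul_eq, sub_mul, Units.inv_mul_cancel_right, hu, hr l, hr m]
    rw [hu, hr m] at hn
    simp only [Algebra.smul_def]
    have e1 : (r l - r m + l - m : ℂ) = (r l + l) - (r m + m) := by ring
    have e2 : (r l * m - r m * l : ℂ) = (r l + l) * m - (r m + m) * l := by ring
    rw [e1, e2, mul_add ((algebraMap ℂ A) (r m + m : ℂ)⁻¹), ← mul_assoc, ← map_mul, ← map_mul,
      mul_add, ← map_mul]
    have e3 : (r m + m : ℂ)⁻¹ * ((r l + l) - (r m + m)) = (r l + l) * (r m + m : ℂ)⁻¹ - 1 := by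
      field_simp
    have e4 : (r m + m : ℂ)⁻¹ * ((r l + l) * m - (r m + m) * l)
        = (r l + l) * (r m + m : ℂ)⁻¹ * m - l := by
      field_simp
    rw [e3, e4, map_sub, map_sub, map_one, sub_mul, one_mul]
    abel
  have hsame : ∀ l m s : ℝ, s ≠ 0 → r ⟨l, s⟩ = r ⟨m, s⟩ := by
    intro l m s hs
    obtain ⟨h, h'⟩ := key ⟨l, s⟩ ⟨m, s⟩ hs
    simp only [Complex.ext_iff, Complex.sub_re, Complex.add_re, Complex.sub_im, Complex.add_im,
      Complex.ofReal_re, Complex.ofReal_im, Complex.re_ofReal_mul, Complex.im_ofReal_mul,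
      Complex.zero_re, Complex.zero_im] at h h'
    have h2 : s * (r ⟨l, s⟩ - r ⟨m, s⟩) * (r ⟨l, s⟩ - r ⟨m, s⟩ + l - m) = 0 := by linarith
    have h3 : s * (r ⟨l, s⟩ - r ⟨m, s⟩) = 0 := by
      rcases mul_eq_zero.1 h2 with h2 | h2
      · exact h2
      · have := (h ⟨h2, by ring⟩).2
        linarith
    exact sub_eq_zero.1 ((mul_eq_zero.1 h3).resolve_left hs)
  have hconst : ∀ l m : ℂ, l.im ≠ 0 → m.im ≠ 0 → r l = r m := by
    rintro ⟨l, s⟩ ⟨m, t⟩ (hs : s ≠ 0) (ht : t ≠ 0)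
    have ha := (key ⟨0, s⟩ ⟨0, t⟩ ht).2
    have hb := (key ⟨0, s⟩ ⟨1, t⟩ ht).2
    rw [hsame l 0 s hs, hsame m 0 t ht]
    rw [hsame 1 0 t ht] at hb
    simp only [Complex.sub_re, Complex.add_re, Complex.sub_im, Complex.add_im,
      Complex.ofReal_re, Complex.ofReal_im, Complex.re_ofReal_mul, Complex.im_ofReal_mul] at ha hb
    have h3 : s * (r ⟨0, s⟩ - r ⟨0, t⟩) = 0 := by linarith
    exact sub_eq_zero.1 ((mul_eq_zero.1 h3).resolve_left hs)
  have hI : (Complex.I).im ≠ 0 := by simp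
  have hd : Dense {z : ℂ | z.im ≠ 0} :=
    (dense_compl_singleton (0 : ℝ)).preimage Complex.isOpenMap_im
  have hall : (fun z => θ (x + algebraMap ℂ A z)) = fun z => (r Complex.I : ℂ) + z := by
    refine Continuous.ext_on hd ?_ (by fun_prop) ?_
    · exact hcont.comp (continuous_const.add (algebraMapCLM ℂ A).continuous)
    · intro z hz
      simp only
      rw [hr z, hconst z _ hz hI]
  have h0 := congrFun hall 0
  simp only [map_zero, add_zero] at h0
  rw [h0]
  exact congrFun hall l

theorem eq_of_mem_spectrum_algebraMap {A : Type*} [Ring A] [Algebra ℂ A] {z k : ℂ}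
    (h : z ∈ spectrum ℂ (algebraMap ℂ A k)) : z = k := by
  by_contra hne
  rw [spectrum.mem_iff, ← map_sub] at h
  exact h ((IsUnit.mk0 _ (sub_ne_zero.2 hne)).map (algebraMap ℂ A))

theorem SpectrallyMultiplicative.mem_spectrum {A : Type*} [Ring A] [Algebra ℂ A] {φ : A → ℂ}
    (hsm : SpectrallyMultiplicative φ) (h1 : φ 1 = 1) (x : A) : φ x ∈ spectrum ℂ x := by
  simpa [h1] using hsm x 1

theorem SpectrallyMultiplicative.apply_unit_ne_zero {A : Type*} [Ring A] [Algebra ℂ A]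
    {φ : A → ℂ} (hsm : SpectrallyMultiplicative φ) (h1 : φ 1 = 1) (u : Aˣ) : φ u ≠ 0 :=
  fun h0 => spectrum.zero_notMem ℂ u.isUnit (h0 ▸ hsm.mem_spectrum h1 u)

theorem SpectrallyMultiplicative.apply_inv {A : Type*} [Ring A] [Algebra ℂ A]
    {φ : A → ℂ} (hsm : SpectrallyMultiplicative φ) (u : Aˣ) : φ ↑u⁻¹ = (φ u)⁻¹ := by
  have h := hsm u ↑u⁻¹
  rw [Units.mul_inv, ← map_one (algebraMap ℂ A)] at h
  exact eq_inv_of_mul_eq_one_right (eq_of_mem_spectrum_algebraMap h)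

theorem SpectrallyMultiplicative.apply_algebraMap {A : Type*} [Ring A] [Algebra ℂ A]
    {φ : A → ℂ} (hsm : SpectrallyMultiplicative φ) (h1 : φ 1 = 1) (k : ℂ) :
    φ (algebraMap ℂ A k) = k :=
  eq_of_mem_spectrum_algebraMap (hsm.mem_spectrum h1 _)

/-- A unit factor and a shifted self-adjoint factor are separated by `φ`. -/
theorem SpectrallyMultiplicative.apply_unit_mul {A : Type*} [NormedRing A] [NormedAlgebra ℂ A]
    [CompleteSpace A] [StarRing A]
    (hHerm : ∀ a : A, star a = a → ∀ z ∈ spectrum ℂ a, z.im = 0)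
    {φ : A → ℂ} (hcont : Continuous φ) (hsm : SpectrallyMultiplicative φ) (h1 : φ 1 = 1)
    (a : Aˣ) {x : A} (hx : star x = x) (l : ℂ) :
    φ (a * (x + algebraMap ℂ A l)) = φ a * (φ x + l) := by
  have ha : φ a ≠ 0 := hsm.apply_unit_ne_zero h1 a
  have hratio : ∀ (x : A) (u : Aˣ), φ x * (φ u)⁻¹ ∈ spectrum ℂ (x * ↑u⁻¹) := fun x u => by
    rw [← hsm.apply_inv]
    exact hsm _ _
  have hshift : ∀ m : ℂ, φ (x + algebraMap ℂ A m) = φ x + m :=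
    ratio_apply_add_algebraMap hHerm hcont h1 hratio hx
  have htrans : ∀ m : ℂ, φ (a * (x + algebraMap ℂ A m)) / φ a = φ (a * x) / φ a + m := by
    refine ratio_apply_add_algebraMap (θ := fun y => φ (a * y) / φ a) hHerm
      ((hcont.comp (continuous_const.mul continuous_id)).div_const _)
      (by rw [mul_one, div_self ha]) ?_ hx
    intro y u
    have h := hratio (a * y) (a * u)
    have e : (a : A) * y * ↑(a * u)⁻¹ = a * (y * ↑u⁻¹) * ↑a⁻¹ := by
      rw [mul_inv_rev, Units.val_mul]
      simp only [mul_assoc]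
    rw [e, spectrum.units_conjugate] at h
    convert h using 1
    have hau : φ (a * u) ≠ 0 := hsm.apply_unit_ne_zero h1 (a * u)
    rw [Units.val_mul]
    field_simp
  have hd : φ (a * x) / φ a - φ x = 0 := by
    set d := φ (a * x) / φ a - φ x with hd
    have hpos : 0 < ‖φ a‖ := norm_pos_iff.2 ha
    set M : ℝ := ‖(a : A)‖ * ‖(1 : A)‖ / ‖φ a‖ + 1 with hM
    have hMpos : 0 < M := by positivity
    have hbound : ∀ ε : ℝ, 0 < ε → ‖d‖ ≤ M * ε := by
      intro ε hε
      have hm : (-φ x + ε * Complex.I).im ≠ 0 := by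
        have := hHerm x hx _ (hsm.mem_spectrum h1 x)
        simp [this, hε.ne']
      obtain ⟨u, hu⟩ := isUnit_selfAdjoint_add hHerm hx hm
      have h := hratio (a * u) u
      rw [Units.mul_inv_cancel_right] at h
      have hb := spectrum.norm_le_norm_mul_of_mem h
      have e1 : φ (a * u) = φ a * (d + ε * Complex.I) := by
        have := htrans (-φ x + ε * Complex.I)
        rw [div_eq_iff ha, ← hu] at this
        rw [this, hd]
        ring
      have e2 : φ u = ε * Complex.I := by
        rw [hu, hshift]
        ring
      rw [e1, e2, norm_mul, norm_mul, norm_inv, norm_mul, Complex.norm_I, mul_one,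
        Complex.norm_real, Real.norm_of_nonneg hε.le, ← div_eq_mul_inv, div_le_iff₀ hε] at hb
      have hb2 : ‖d + ε * Complex.I‖ ≤ ‖(a : A)‖ * ‖(1 : A)‖ / ‖φ a‖ * ε := by
        rw [div_mul_eq_mul_div, le_div_iff₀ hpos]
        linarith
      have hb3 : ‖d‖ ≤ ‖d + ε * Complex.I‖ + ε := by
        have := norm_sub_le (d + ε * Complex.I) (ε * Complex.I)
        rwa [add_sub_cancel_right, norm_mul, Complex.norm_I, mul_one,
          Complex.norm_real, Real.norm_of_nonneg hε.le] at this
      rw [hM]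
      linarith
    by_contra hne
    have hdpos : 0 < ‖d‖ := norm_pos_iff.2 hne
    have := hbound (‖d‖ / (2 * M)) (by positivity)
    have e : M * (‖d‖ / (2 * M)) = ‖d‖ / 2 := by field_simp
    linarith
  have := htrans l
  rw [div_eq_iff ha, sub_eq_zero.1 hd] at this
  rw [this]
  ring

/-- `φ` is additive and homogeneous on complex multiples of `y² + 1`; off the real axis the
resulting elements are invertible. -/
theorem SpectrallyMultiplicative.apply_add_smul_sq {A : Type*} [NormedRing A] [NormedAlgebra ℂ A]
    [CompleteSpace A] [StarRing A] [StarModule ℂ A]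
    (hHerm : ∀ a : A, star a = a → ∀ z ∈ spectrum ℂ a, z.im = 0)
    {φ : A → ℂ} (hcont : Continuous φ) (hsm : SpectrallyMultiplicative φ) (h1 : φ 1 = 1)
    {x y : A} (hx : star x = x) (hy : star y = y) :
    (∀ l : ℂ, l.im ≠ 0 → IsUnit (x + l • (y * y + 1))) ∧
      ∀ l : ℂ, φ (x + l • (y * y + 1)) = φ x + l * (φ y ^ 2 + 1) := by
  have hB := fun (a : Aˣ) (z : A) (hz : star z = z) (l : ℂ) =>
    hsm.apply_unit_mul hHerm hcont h1 a hz l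
  obtain ⟨u, hu⟩ := isUnit_selfAdjoint_add hHerm hy (l := Complex.I) (by simp)
  have hv : ((star u : Aˣ) : A) = y + algebraMap ℂ A (-Complex.I) := by
    rw [Units.coe_star, hu, star_add, hy, ← algebraMap_star_comm]
    simp
  have huv : (u : A) * (star u : Aˣ) = y * y + 1 := by
    have hI : algebraMap ℂ A Complex.I * algebraMap ℂ A Complex.I = -1 := by
      rw [← map_mul, Complex.I_mul_I, map_neg, map_one]
    rw [hu, hv, map_neg, ← sub_eq_add_neg, add_mul, mul_sub, mul_sub, hI,
      Algebra.commutes Complex.I y]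
    abel
  set z : A := ↑u⁻¹ * x * ↑(star u)⁻¹ with hz
  have hzs : star z = z := by
    rw [hz, star_mul, star_mul, hx, ← Units.coe_star, ← Units.coe_star, star_inv, star_star,
      star_inv, mul_assoc]
  have hprod : ∀ l : ℂ, (u : A) * (z + algebraMap ℂ A l) * (star u : Aˣ)
      = x + l • (y * y + 1) := by
    intro l
    rw [mul_add, add_mul, hz, mul_assoc (↑u⁻¹ : A), Units.mul_inv_cancel_left,
      Units.inv_mul_cancel_right, ← Algebra.commutes l (u : A), mul_assoc, huv, Algebra.smul_def]
  have hφu : φ u = φ y + Complex.I := by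
    simpa [hu, h1] using hB 1 y hy Complex.I
  have hunit : ∀ l : ℂ, l.im ≠ 0 → IsUnit ((u : A) * (z + algebraMap ℂ A l)) :=
    fun l hl => u.isUnit.mul (isUnit_selfAdjoint_add hHerm hzs hl)
  have hoff : ∀ l : ℂ, l.im ≠ 0 →
      φ (x + l • (y * y + 1)) = (φ y ^ 2 + 1) * (φ z + l) := by
    intro l hl
    obtain ⟨w, hw⟩ := hunit l hl
    rw [← hprod l, ← hw, hv, hB w y hy, hw, hB u z hzs, hφu]
    linear_combination (-(φ z + l)) * Complex.I_sq
  have hall : (fun l : ℂ => φ (x + l • (y * y + 1))) = fun l => (φ y ^ 2 + 1) * (φ z + l) := by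
    have hd : Dense {z : ℂ | z.im ≠ 0} :=
      (dense_compl_singleton (0 : ℝ)).preimage Complex.isOpenMap_im
    exact Continuous.ext_on hd (by fun_prop) (by fun_prop) fun l hl => hoff l hl
  refine ⟨fun l hl => hprod l ▸ (hunit l hl).mul (star u).isUnit, fun l => ?_⟩
  have h0 := congrFun hall 0
  have hl := congrFun hall l
  simp only [zero_smul, add_zero] at h0 hl
  rw [hl, h0]
  ring

theorem SpectrallyMultiplicative.apply_smul_selfAdjoint {A : Type*} [NormedRing A]
    [NormedAlgebra ℂ A] [CompleteSpace A] [StarRing A]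
    (hHerm : ∀ a : A, star a = a → ∀ z ∈ spectrum ℂ a, z.im = 0)
    {φ : A → ℂ} (hcont : Continuous φ) (hsm : SpectrallyMultiplicative φ) (h1 : φ 1 = 1)
    {x : A} (hx : star x = x) (t : ℂ) : φ (t • x) = t * φ x := by
  rcases eq_or_ne t 0 with rfl | ht
  · simpa using hsm.apply_algebraMap h1 0
  · obtain ⟨u, hu⟩ := (IsUnit.mk0 t ht).map (algebraMap ℂ A)
    have := hsm.apply_unit_mul hHerm hcont h1 u hx 0
    rwa [map_zero, add_zero, add_zero, hu, hsm.apply_algebraMap h1, ← Algebra.smul_def] at this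

theorem SpectrallyMultiplicative.apply_add_sq {A : Type*} [NormedRing A]
    [NormedAlgebra ℂ A] [CompleteSpace A] [StarRing A] [StarModule ℂ A]
    (hHerm : ∀ a : A, star a = a → ∀ z ∈ spectrum ℂ a, z.im = 0)
    {φ : A → ℂ} (hcont : Continuous φ) (hsm : SpectrallyMultiplicative φ) (h1 : φ 1 = 1)
    {x y : A} (hx : star x = x) (hy : star y = y) : φ (x + y * y) = φ x + φ y ^ 2 := by
  have hxy : star (x + y * y) = x + y * y := by rw [star_add, star_mul, hx, hy]
  have h := (hsm.apply_add_smul_sq hHerm hcont h1 hx hy).2 1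
  have h' := hsm.apply_unit_mul hHerm hcont h1 1 hxy 1
  rw [Units.val_one, one_mul, map_one, h1, one_mul] at h'
  rw [one_smul, ← add_assoc, h'] at h
  linear_combination h

theorem SpectrallyMultiplicative.apply_add_selfAdjoint {A : Type*} [NormedRing A]
    [NormedAlgebra ℂ A] [CompleteSpace A] [StarRing A] [StarModule ℂ A]
    (hHerm : ∀ a : A, star a = a → ∀ z ∈ spectrum ℂ a, z.im = 0)
    {φ : A → ℂ} (hcont : Continuous φ) (hsm : SpectrallyMultiplicative φ) (h1 : φ 1 = 1)
    {x y : A} (hx : star x = x) (hy : star y = y) : φ (x + y) = φ x + φ y := by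
  have hsmul := fun (t : ℂ) (z : A) (hz : star z = z) =>
    hsm.apply_smul_selfAdjoint hHerm hcont h1 hz t
  have hsq := fun (z w : A) (hz : star z = z) (hw : star w = w) =>
    hsm.apply_add_sq hHerm hcont h1 hz hw
  have hshift : ∀ m : ℂ, φ (y + algebraMap ℂ A m) = φ y + m := fun m => by
    simpa [h1] using hsm.apply_unit_mul hHerm hcont h1 1 hy m
  have hy4 : star ((4 : ℂ) • y) = (4 : ℂ) • y := by simp [star_smul, hy]
  have hx4 : star ((4 : ℂ) • x) = (4 : ℂ) • x := by simp [star_smul, hx]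
  have hp : star (y + algebraMap ℂ A 1) = y + algebraMap ℂ A 1 := by simp [hy]
  have hm : star (y + algebraMap ℂ A (-1)) = y + algebraMap ℂ A (-1) := by simp [hy]
  have hxy : star (x + y) = x + y := by rw [star_add, hx, hy]
  have a1 := hsq _ _ hx4 hp
  have a2 := hsq _ _ (by rw [star_add, hx4, hy4] :
    star ((4 : ℂ) • x + (4 : ℂ) • y) = (4 : ℂ) • x + (4 : ℂ) • y) hm
  have e : (4 : ℂ) • x + (4 : ℂ) • y + (y + algebraMap ℂ A (-1)) * (y + algebraMap ℂ A (-1))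
      = (4 : ℂ) • x + (y + algebraMap ℂ A 1) * (y + algebraMap ℂ A 1) := by
    have : (4 : ℂ) • y = y + y + y + y := by module
    rw [map_neg, map_one, this]
    noncomm_ring
  rw [e, a1, hshift, hshift, ← smul_add, hsmul 4 _ hxy, hsmul 4 _ hx] at a2
  linear_combination (-1 / 4) * a2

theorem Complex.exists_mul_one_sub_eq_of_mem_slitPlane {z : ℂ} (hz : z ∈ Complex.slitPlane) :
    ∃ G T : ℝ, 0 < G ∧ z * (1 - T * Complex.I) = G * (1 + T * Complex.I) := by
  have hpos : 0 < ‖z‖ + z.re := by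
    rcases Complex.mem_slitPlane_iff.1 hz with h | h
    · have := norm_nonneg z
      linarith
    · have := (abs_lt.1 (Complex.abs_re_lt_norm.2 h)).1
      linarith
  have hsq : ‖z‖ ^ 2 = z.re ^ 2 + z.im ^ 2 := by
    rw [Complex.sq_norm, Complex.normSq_apply]
    ring
  refine ⟨‖z‖, z.im / (‖z‖ + z.re), norm_pos_iff.2 (Complex.slitPlane_ne_zero hz), ?_⟩
  have hT : z.im / (‖z‖ + z.re) * (‖z‖ + z.re) = z.im := div_mul_cancel₀ _ hpos.ne'
  set T := z.im / (‖z‖ + z.re)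
  refine Complex.ext ?_ ?_
  · simp
    refine mul_right_cancel₀ hpos.ne' ?_
    linear_combination z.im * hT - hsq
  · simp
    linear_combination -hT

theorem star_reP {A : Type*} [Ring A] [Algebra ℂ A] [StarRing A] [StarModule ℂ A] (x : A) :
    star (reP x) = reP x := by
  simp [reP, star_smul, add_comm]

theorem star_imP {A : Type*} [Ring A] [Algebra ℂ A] [StarRing A] [StarModule ℂ A] (x : A) :
    star (imP x) = imP x := by
  simp only [imP, star_smul, star_sub, star_star, star_inv₀, star_mul',
    RCLike.star_def, Complex.conj_I, map_ofNat]
  rw [← neg_sub x (star x), smul_neg, ← neg_smul, mul_neg, inv_neg, neg_neg]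

theorem reP_add_I_smul_imP {A : Type*} [Ring A] [Algebra ℂ A] [StarRing A] (x : A) :
    reP x + Complex.I • imP x = x := by
  rw [reP, imP, smul_smul]
  have : Complex.I * (2 * Complex.I)⁻¹ = 2⁻¹ := by field_simp
  rw [this]
  module

theorem stmt_8 {A : Type*} [NormedRing A] [NormedAlgebra ℂ A] [CompleteSpace A]
    [StarRing A] [StarModule ℂ A]
    (hHerm : ∀ a : A, star a = a → ∀ z ∈ spectrum ℂ a, z.im = 0)
    (φ : A → ℂ) (hcont : Continuous φ) (hsm : SpectrallyMultiplicative φ)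
    (h1 : φ 1 = 1) (α : ℂ) (x : A)
    (hx : φ (reP x) + Complex.I * φ (imP x) = 0) :
    ∃ c : ℝ, c ∈ Set.Icc (0 : ℝ) 1 ∧ φ (α • (1 : A) + x) = (c : ℂ) * α := by
  have hadd := fun {y z : A} (hy : star y = y) (hz : star z = z) =>
    hsm.apply_add_selfAdjoint hHerm hcont h1 hy hz
  have hsmul := fun {y : A} (hy : star y = y) (t : ℂ) =>
    hsm.apply_smul_selfAdjoint hHerm hcont h1 hy t
  have hstar : ∀ (t : ℝ) {y : A}, star y = y → star ((t : ℂ) • y) = (t : ℂ) • y := by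
    intro t y hy
    rw [star_smul, hy, RCLike.star_def, Complex.conj_ofReal]
  have hsum : ∀ {y z : A}, star y = y → star z = z → star (y + z) = y + z := by
    intro y z hy hz
    rw [star_add, hy, hz]
  have hP := star_reP x
  have hQ := star_imP x
  have hPim := hHerm _ hP _ (hsm.mem_spectrum h1 (reP x))
  have hQim := hHerm _ hQ _ (hsm.mem_spectrum h1 (imP x))
  have hdecomp := reP_add_I_smul_imP x
  set P := reP x
  set Q := imP x
  have hφP : φ P = 0 := by
    refine Complex.ext ?_ hPim
    simpa [hQim] using congrArg Complex.re hx
  have hφQ : φ Q = 0 := by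
    simpa [hφP] using hx
  set y := α • (1 : A) + x with hy
  set β := φ y with hβ
  rcases eq_or_ne β 0 with hβ0 | hβ0
  · exact ⟨0, by simp, by simp [hβ0]⟩
  by_cases hslit : 1 - α / β ∈ Complex.slitPlane
  · exfalso
    obtain ⟨G, T, hG, hGT⟩ := Complex.exists_mul_one_sub_eq_of_mem_slitPlane hslit
    have hGc : (G : ℂ) ≠ 0 := by exact_mod_cast hG.ne'
    set δ : ℂ := 1 - T * Complex.I with hδ
    have hδ0 : δ ≠ 0 := fun h0 => by simpa [hδ] using congrArg Complex.re h0
    set a := (δ / β).re with ha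
    set b := (δ / β).im with hb
    have hab : δ / β = a + b * Complex.I := (Complex.re_add_im _).symm
    set p : A := (a : ℂ) • P + ((-b : ℝ) : ℂ) • Q with hp
    set q : A := (a : ℂ) • Q + (b : ℂ) • P with hq
    have hps : star p = p := by rw [hp, star_add, hstar _ hP, hstar _ hQ]
    have hqs : star q = q := by rw [hq, star_add, hstar _ hP, hstar _ hQ]
    have hφp : φ p = 0 := by
      rw [hp, hadd (hstar _ hP) (hstar _ hQ), hsmul hP, hsmul hQ, hφP, hφQ]
      simp
    have hφq : φ q = 0 := by
      rw [hq, hadd (hstar _ hQ) (hstar _ hP), hsmul hP, hsmul hQ, hφP, hφQ]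
      simp
    have hpq : p + Complex.I • q = (δ / β) • x := by
      rw [← hdecomp, hab, hp, hq]
      push_cast
      have := Complex.I_mul_I
      match_scalars
      · ring
      · linear_combination (-b : ℂ) * this
    obtain ⟨r, hr⟩ : ∃ r : ℝ, r * r = (2 * G)⁻¹ :=
      ⟨√(2 * G)⁻¹, Real.mul_self_sqrt (by positivity)⟩
    have hrc : (r : ℂ) * r = (2 * G : ℂ)⁻¹ := by exact_mod_cast congrArg (Complex.ofReal) hr
    set w : A := (r : ℂ) • p with hw
    have hws : star w = w := hstar r hps
    have hφw : φ w = 0 := by rw [hw, hsmul hps, hφp, mul_zero]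
    have hwws : star (w * w) = w * w := by rw [star_mul, hws]
    have hφww : φ (w * w) = 0 := by
      have h0 : φ 0 = 0 := by simpa using hsm.apply_algebraMap h1 0
      have := hsm.apply_add_sq hHerm hcont h1 (star_zero A) hws
      simpa [h0, hφw] using this
    have h1s : star (1 : A) = 1 := star_one A
    set v : A := q + (((-T : ℝ) : ℂ) • 1 + ((T : ℂ) • (w * w) + ((-T : ℝ) : ℂ) • p)) with hv
    have hs1 := hstar (-T) h1s
    have hs2 := hstar T hwws
    have hs3 := hstar (-T) hps
    have hs4 := hsum hs2 hs3
    have hs5 := hsum hs1 hs4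
    have hvs : star v = v := hsum hqs hs5
    have hφv : φ v = -T := by
      rw [hv, hadd hqs hs5, hadd hs1 hs4, hadd hs2 hs3, hsmul h1s, hsmul hwws, hsmul hps,
        hφq, hφww, hφp, h1]
      simp
    obtain ⟨hunit, hval⟩ := hsm.apply_add_smul_sq hHerm hcont h1 hvs hws
    obtain ⟨u, hu⟩ := hunit (-Complex.I) (by simp)
    have hφu : φ u = -Complex.I * δ := by
      rw [hu, hval, hφv, hφw, hδ]
      linear_combination (-T : ℂ) * Complex.I_mul_I
    have hmem := hsm y ↑u⁻¹
    rw [hsm.apply_inv, ← hβ, hφu] at hmem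
    have hI := Complex.I_mul_I
    have hβα : β - α ≠ 0 := by
      intro h0
      apply Complex.slitPlane_ne_zero hslit
      rw [← sub_eq_zero.1 h0, div_self hβ0, sub_self]
    have hκ : (β - α) / G * δ = β * (1 + T * Complex.I) := by
      field_simp at hGT ⊢
      linear_combination hGT
    have hk : β * (-Complex.I * δ)⁻¹ = Complex.I * (β / δ) := by
      rw [mul_inv, inv_neg, Complex.inv_I]
      ring
    have hquad : (2 * G : ℂ)⁻¹ • ((p + algebraMap ℂ A (-G + G * Complex.I)) *
        (p + algebraMap ℂ A (-G - G * Complex.I))) = w * w - p + (G : ℂ) • (1 : A) := by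
      rw [Algebra.algebraMap_eq_smul_one, Algebra.algebraMap_eq_smul_one, hw, smul_mul_smul_comm,
        hrc]
      simp only [add_mul, mul_add, smul_mul_assoc, mul_smul_comm, one_mul, mul_one]
      match_scalars
      · ring
      · field_simp
        ring
      · field_simp
        ring
      · field_simp
        linear_combination (-1 : ℂ) * hI
    have hquadU : IsUnit (w * w - p + (G : ℂ) • (1 : A)) := by
      rw [← hquad, Algebra.smul_def]
      exact ((IsUnit.mk0 _ (by simpa using hGc)).map (algebraMap ℂ A)).mul
        ((isUnit_selfAdjoint_add hHerm hps (by simpa using hG.ne')).mul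
          (isUnit_selfAdjoint_add hHerm hps (by simpa using hG.ne')))
    have hkey : (Complex.I * (β / δ)) • (u : A) - y
        = ((β - α) / G) • (w * w - p + (G : ℂ) • (1 : A)) := by
      have hIq : Complex.I • q = (δ / β) • x - p := by rw [← hpq]; abel
      have hβδq : (Complex.I * (β / δ)) • q = x - (β / δ) • p := by
        rw [mul_comm, mul_smul, hIq, smul_sub, smul_smul]
        have : β / δ * (δ / β) = 1 := by field_simp
        rw [this, one_smul]
      have hκ' : (β - α) / G = β / δ * (1 + T * Complex.I) := by
        rw [div_mul_eq_mul_div, eq_div_iff hδ0, hκ]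
      have hαβ : (β - α) / G * G = β - α := div_mul_cancel₀ _ hGc
      rw [smul_add, smul_smul, hαβ, hκ', hu, hv, smul_add, smul_add, hβδq, hy]
      push_cast
      have hδβ : β / δ * (1 - T * Complex.I) = β := by rw [← hδ]; field_simp
      match_scalars
      · ring
      · ring
      · ring
      · linear_combination hδβ - (β / δ) * hI
      · linear_combination (-(β / δ)) * hI
    rw [spectrum.mem_iff, hk] at hmem
    apply hmem
    have hprod := (((IsUnit.mk0 _ (div_ne_zero hβα hGc)).map (algebraMap ℂ A)).mul hquadU).mul
      u⁻¹.isUnit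
    rw [← Algebra.smul_def, ← hkey, sub_mul, smul_mul_assoc, Units.mul_inv,
      ← Algebra.algebraMap_eq_smul_one] at hprod
    exact hprod
  · rw [Complex.mem_slitPlane_iff, not_or, not_lt, not_not] at hslit
    obtain ⟨hre, him⟩ := hslit
    set t : ℝ := 1 - (1 - α / β).re with ht
    have ht1 : 1 ≤ t := by linarith
    have htα : α / β = t := by
      refine Complex.ext ?_ ?_
      · simp [ht]
      · simpa using him
    have htc : (t : ℂ) ≠ 0 := by exact_mod_cast (by linarith : t ≠ 0)
    refine ⟨t⁻¹, ⟨by positivity, inv_le_one_of_one_le₀ ht1⟩, ?_⟩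
    rw [div_eq_iff hβ0] at htα
    rw [htα, Complex.ofReal_inv, inv_mul_cancel_left₀ htc]
end

section
/- Let A be a Hermitian algebra and let φ : A → ℂ be a continuous spectrally multiplicative function with φ(1) = 1. If α ∈ ℂ and x ∈ A satisfies φ(Re(x)) + i·φ(Im(x)) = 0, then φ(α·1 + x) ∈ {0, α}. -/
open scoped ComplexConjugate

section Hermitian

variable {A : Type*} [Ring A] [Algebra ℂ A]

/-- If `c • a + d • 1` is not invertible and `a` has real spectrum, then `c * u + d = 0` has a
real solution `u`. -/
lemma exists_real_root_of_not_isUnit [Nontrivial A] {a : A} (ha : ∀ z ∈ spectrum ℂ a, z.im = 0)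
    {c d : ℂ} (h : ¬ IsUnit (c • a + d • (1 : A))) : ∃ u : ℝ, c * u + d = 0 := by
  by_cases hc : c = 0
  · refine ⟨0, ?_⟩
    by_contra hd
    have hd' : d ≠ 0 := by simpa using hd
    apply h
    rw [hc, zero_smul, zero_add, ← Algebra.algebraMap_eq_smul_one]
    exact (IsUnit.mk0 d hd').map (algebraMap ℂ A)
  · have hmem : -(d / c) ∈ spectrum ℂ a := by
      rw [spectrum.mem_iff]
      intro hu
      apply h
      have := hu.smul (Units.mk0 (-c) (neg_ne_zero.mpr hc))
      convert this using 1
      rw [Units.smul_mk0, Algebra.algebraMap_eq_smul_one, smul_sub, smul_smul]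
      have : -c * -(d / c) = d := by field_simp
      rw [this, neg_smul]
      abel
    refine ⟨(-(d / c)).re, ?_⟩
    have : (((-(d / c)).re : ℝ) : ℂ) = -(d / c) := Complex.ext (by simp) (by
      simpa using (ha _ hmem).symm)
    rw [this]
    field_simp
    ring

namespace SpectrallyMultiplicative

variable {φ : A → ℂ}

lemma nontrivial (hsm : SpectrallyMultiplicative φ) : Nontrivial A := by
  by_contra h
  rw [not_nontrivial_iff_subsingleton] at h
  have := hsm 1 1
  rw [spectrum.of_subsingleton] at this
  exact this

lemma not_isUnit_sub (hsm : SpectrallyMultiplicative φ) (h1 : φ 1 = 1) (y : A) :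
    ¬ IsUnit (φ y • (1 : A) - y) := by
  have := hsm y 1
  rwa [h1, mul_one, mul_one, spectrum.mem_iff, Algebra.algebraMap_eq_smul_one] at this

lemma mul_inv_eq_one (hsm : SpectrallyMultiplicative φ) (u : Aˣ) :
    φ u * φ (↑u⁻¹ : A) = 1 := by
  have := hsm.nontrivial
  simpa using hsm u (↑u⁻¹ : A)

lemma ne_zero_of_isUnit (hsm : SpectrallyMultiplicative φ) {u : A} (hu : IsUnit u) :
    φ u ≠ 0 := by
  obtain ⟨u, rfl⟩ := hu
  exact left_ne_zero_of_mul_eq_one (hsm.mul_inv_eq_one u)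

lemma not_isUnit_smul_sub_smul (hsm : SpectrallyMultiplicative φ) {u : A} (hu : IsUnit u)
    (y : A) : ¬ IsUnit (φ y • u - φ u • y) := by
  have hne := hsm.ne_zero_of_isUnit hu
  obtain ⟨u, rfl⟩ := hu
  have hinv := hsm.mul_inv_eq_one u
  have hmem := hsm y (↑u⁻¹ : A)
  rw [spectrum.mem_iff] at hmem
  intro hunit
  apply hmem
  have h := (hunit.mul (u⁻¹).isUnit).smul (Units.mk0 (φ u) hne)⁻¹
  convert h using 1
  have hval : φ (↑u⁻¹ : A) = (φ u)⁻¹ := eq_inv_of_mul_eq_one_right hinv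
  rw [Units.smul_def, Units.val_inv_eq_inv_val, Units.val_mk0, Algebra.algebraMap_eq_smul_one,
    sub_mul, smul_mul_assoc, smul_mul_assoc, Units.mul_inv, smul_sub, smul_smul, smul_smul,
    inv_mul_cancel₀ hne, one_smul, hval, mul_comm]

lemma map_smul_of_isUnit (hsm : SpectrallyMultiplicative φ) {u : A} (hu : IsUnit u) (c : ℂ) :
    φ (c • u) = c * φ u := by
  by_contra hne
  apply hsm.not_isUnit_smul_sub_smul hu (c • u)
  rw [smul_smul, ← sub_smul]
  rw [mul_comm (φ u)]
  exact hu.smul (Units.mk0 _ (sub_ne_zero.mpr hne))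

end SpectrallyMultiplicative

lemma isUnit_smul_one_add [Nontrivial A] {a : A} (ha : ∀ z ∈ spectrum ℂ a, z.im = 0) {τ : ℂ}
    (hτ : τ.im ≠ 0) : IsUnit (τ • (1 : A) + a) := by
  by_contra h
  obtain ⟨u, hu⟩ := exists_real_root_of_not_isUnit (c := 1) (d := τ) ha
    (by rwa [one_smul, add_comm])
  apply hτ
  simpa using congrArg Complex.im hu

end Hermitian

/-- A continuous spectrally multiplicative function respects non-real scalar translations of
elements with real spectrum. -/
lemma SpectrallyMultiplicative.map_smul_one_add {A : Type*} [NormedRing A] [NormedAlgebra ℂ A]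
    {φ : A → ℂ} (hsm : SpectrallyMultiplicative φ) (hcont : Continuous φ) (h1 : φ 1 = 1) {a : A}
    (ha : ∀ z ∈ spectrum ℂ a, z.im = 0) {τ : ℂ} (hτ : τ.im ≠ 0) :
    φ (τ • (1 : A) + a) = τ + φ a := by
  have := hsm.nontrivial
  have hs : ∀ τ : ℂ, ∃ s : ℝ, φ (τ • (1 : A) + a) = τ + s := by
    intro τ
    obtain ⟨u, hu⟩ := exists_real_root_of_not_isUnit (c := -1) (d := φ (τ • (1 : A) + a) - τ) ha
      (by
        convert hsm.not_isUnit_sub h1 (τ • (1 : A) + a) using 2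
        rw [sub_smul, neg_smul, one_smul]
        abel)
    exact ⟨u, by linear_combination hu⟩
  choose s hs using hs
  have hroot : ∀ τ τ' : ℂ, τ'.im ≠ 0 → ∃ u : ℝ,
      (τ.re - τ'.re + s τ - s τ') * u + (s τ * τ'.re - s τ' * τ.re) = 0 ∧
        (τ.im - τ'.im) * u + (s τ * τ'.im - s τ' * τ.im) = 0 := by
    intro τ τ' hτ'
    obtain ⟨u, hu⟩ := exists_real_root_of_not_isUnit
      (c := τ + s τ - (τ' + s τ')) (d := s τ * τ' - s τ' * τ) ha (by
        convert hsm.not_isUnit_smul_sub_smul (isUnit_smul_one_add ha hτ') (τ • (1 : A) + a) using 2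
        rw [hs, hs]
        module)
    refine ⟨u, ?_, ?_⟩
    · have := congrArg Complex.re hu
      simp at this
      linarith
    · have := congrArg Complex.im hu
      simp at this
      linarith
  have hsame : ∀ τ τ' : ℂ, τ'.im ≠ 0 → τ.im = τ'.im → s τ = s τ' := by
    intro τ τ' hτ' him
    obtain ⟨u, -, hu⟩ := hroot τ τ' hτ'
    rw [him] at hu
    exact mul_right_cancel₀ hτ' (by linarith)
  have hconst : ∀ τ τ' : ℂ, τ.im ≠ 0 → τ'.im ≠ 0 → s τ = s τ' := by
    intro τ τ' hτ hτ'
    by_cases him : τ.im = τ'.im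
    · exact hsame τ τ' hτ' him
    obtain ⟨u, hu, hu'⟩ := hroot τ τ' hτ'
    obtain ⟨v, hv, hv'⟩ := hroot (τ + 1) τ' hτ'
    rw [hsame (τ + 1) τ hτ (by simp)] at hv hv'
    simp only [Complex.add_im, Complex.one_im, add_zero, Complex.add_re, Complex.one_re] at hv hv'
    have huv : v = u := mul_left_cancel₀ (sub_ne_zero.mpr him) (by linarith)
    rw [huv] at hv
    have hu_eq : u = s τ' := by linarith
    rw [hu_eq] at hu'
    exact mul_right_cancel₀ hτ' (by linarith)
  have hlim : φ a = s τ := by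
    have hclosed : IsClosed {t : ℝ | φ ((t * Complex.I) • (1 : A) + a) = t * Complex.I + s τ} :=
      isClosed_eq (by fun_prop) (by fun_prop)
    have hdense : Dense ({0}ᶜ : Set ℝ) := dense_compl_singleton 0
    have hmem : (0 : ℝ) ∈ {t : ℝ | φ ((t * Complex.I) • (1 : A) + a) = t * Complex.I + s τ} := by
      refine hclosed.closure_subset_iff.mpr ?_ (hdense 0)
      intro t ht
      have ht' : ((t : ℂ) * Complex.I).im ≠ 0 := by simpa using ht
      rw [Set.mem_ofPred_eq, hs, hconst _ τ ht' hτ]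
    simpa using hmem
  rw [hs, hlim]

theorem stmt_9 {A : Type*} [NormedRing A] [NormedAlgebra ℂ A] [CompleteSpace A]
    [StarRing A] [StarModule ℂ A]
    (hHerm : ∀ a : A, star a = a → ∀ z ∈ spectrum ℂ a, z.im = 0)
    (φ : A → ℂ) (hcont : Continuous φ) (hsm : SpectrallyMultiplicative φ)
    (h1 : φ 1 = 1) (α : ℂ) (x : A)
    (hx : φ (reP x) + Complex.I * φ (imP x) = 0) :
    φ (α • (1 : A) + x) = 0 ∨ φ (α • (1 : A) + x) = α := by
  have := hsm.nontrivial
  set a := reP x with ha_def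
  set b := imP x with hb_def
  have hsa : star a = a := by
    simp [ha_def, reP, add_comm]
  have hsb : star b = b := by
    rw [hb_def, imP, star_smul, star_sub, star_star, ← neg_sub x (star x), smul_neg, ← neg_smul]
    simp
  have hxab : x = a + Complex.I • b := by
    rw [ha_def, hb_def, reP, imP, smul_smul,
      show Complex.I * ((2 : ℂ) * Complex.I)⁻¹ = (2 : ℂ)⁻¹ by field_simp]
    module
  have ha := hHerm a hsa
  have hb := hHerm b hsb
  have hreal : ∀ y : A, (∀ z ∈ spectrum ℂ y, z.im = 0) → (φ y).im = 0 := fun y hy =>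
    hy _ (by simpa [h1] using hsm y 1)
  have hφa : φ a = 0 := by
    apply Complex.ext
    · simpa [hreal b hb] using congrArg Complex.re hx
    · exact hreal a ha
  have hφb : φ b = 0 := by
    simpa [hφa] using hx
  have hre : ∀ α : ℂ, (φ (α • (1 : A) + x)).im ≠ 0 → (φ (α • (1 : A) + x)).re = α.re := by
    intro α hβ
    have h := hsm.not_isUnit_smul_sub_smul (isUnit_smul_one_add ha hβ) (α • (1 : A) + x)
    rw [hsm.map_smul_one_add hcont h1 ha hβ, hφa, add_zero, ← smul_sub] at h
    set β := φ (α • (1 : A) + x)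
    have hβ0 : β ≠ 0 := fun h0 => hβ (by simp [h0])
    obtain ⟨u, hu⟩ := exists_real_root_of_not_isUnit (c := -Complex.I) (d := β - α) hb (by
      intro hu
      apply h
      convert hu.smul (Units.mk0 β hβ0) using 1
      rw [Units.smul_mk0, hxab]
      module)
    have := congrArg Complex.re hu
    simp at this
    linarith
  have him : ∀ α : ℂ, (φ (α • (1 : A) + x)).re ≠ 0 → (φ (α • (1 : A) + x)).im = α.im := by
    intro α hβ
    set β := φ (α • (1 : A) + x) with hβ_def
    have hβ0 : β ≠ 0 := fun h0 => hβ (by simp [h0])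
    have hτ : (-Complex.I * β).im ≠ 0 := by simpa using hβ
    have hunit := isUnit_smul_one_add hb hτ
    have hval := hsm.map_smul_of_isUnit hunit Complex.I
    rw [hsm.map_smul_one_add hcont h1 hb hτ, hφb, add_zero, ← mul_assoc, mul_neg,
      Complex.I_mul_I, neg_neg, one_mul] at hval
    have h := hsm.not_isUnit_smul_sub_smul
      (hunit.smul (Units.mk0 Complex.I Complex.I_ne_zero)) (α • (1 : A) + x)
    rw [Units.smul_mk0, hval, ← hβ_def, ← smul_sub] at h
    obtain ⟨u, hu⟩ := exists_real_root_of_not_isUnit (c := -1) (d := β - α) ha (by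
      intro hu
      apply h
      convert hu.smul (Units.mk0 β hβ0) using 1
      rw [Units.smul_mk0, hxab, smul_add Complex.I, smul_smul Complex.I, ← mul_assoc, mul_neg,
        Complex.I_mul_I, neg_neg, one_mul]
      module)
    have := congrArg Complex.im hu
    simp at this
    linarith
  have hgeneric : ∀ α : ℂ, α.re ≠ 0 → α.im ≠ 0 →
      φ (α • (1 : A) + x) * (φ (α • (1 : A) + x) - α) = 0 := by
    intro α hαre hαim
    rw [mul_eq_zero, sub_eq_zero]
    by_cases hβ : (φ (α • (1 : A) + x)).im = 0
    · left
      refine Complex.ext ?_ hβ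
      by_contra hβre
      exact hαim ((him α hβre).symm.trans hβ)
    · right
      have h := hre α hβ
      exact Complex.ext h (him α (h ▸ hαre))
  let γ : ℝ → ℂ := fun t => α + t * (1 + Complex.I)
  have hγ : Continuous γ := by fun_prop
  have hclosed : IsClosed {t : ℝ | φ (γ t • (1 : A) + x) * (φ (γ t • (1 : A) + x) - γ t) = 0} :=
    isClosed_eq (by fun_prop) continuous_const
  have hdense : Dense ({-α.re, -α.im}ᶜ : Set ℝ) :=
    (Set.toFinite {-α.re, -α.im}).countable.dense_compl ℝ
  have hmem : (0 : ℝ) ∈ {t : ℝ | φ (γ t • (1 : A) + x) * (φ (γ t • (1 : A) + x) - γ t) = 0} := by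
    refine hclosed.closure_subset_iff.mpr ?_ (hdense 0)
    intro t ht
    simp only [Set.mem_compl_iff, Set.mem_insert_iff, Set.mem_singleton_iff, not_or] at ht
    refine hgeneric (γ t) (fun h => ht.1 ?_) (fun h => ht.2 ?_)
    · simp [γ] at h
      linarith
    · simp [γ] at h
      linarith
  simpa [γ, sub_eq_zero] using hmem
end
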